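/- For every fixed prime p, the ratio a_{n−1,p}/a_{n,p} tends to 0 as n → ∞: lim_{n→∞} a_{n−1,p}/a_{n,p} = 0. -/

import Mathlib

open Finset Pointwise

/-- `a_{n,p}(k)` as the explicit sum `∑_{1≤i₁<⋯<i_k≤n} p^{i₁+⋯+i_k - k(k+1)/2}` over
increasing index tuples, encoded as `k`-element subsets of `{1, …, n}`. -/
def aFormula (p n k : ℕ) : ℕ :=
  ∑ s ∈ (Finset.Icc 1 n).powersetCard k, p ^ ((∑ i ∈ s, i) - k * (k + 1) / 2)

/-- `a_{n,p}(k)`: `1` if `k = 0` or `k = n`, and the explicit sum otherwise. -/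
def aNPK (p n k : ℕ) : ℕ := if k = 0 ∨ k = n then 1 else aFormula p n k

/-- `a_{n,p} = ∑_{k=0}^n a_{n,p}(k)`. -/
def aNP (p n : ℕ) : ℕ := ∑ k ∈ Finset.range (n + 1), aNPK p n k

/-- A finite set of positive integers with `k` elements has sum at least `k (k + 1) / 2`. -/
theorem card_mul_card_succ_half_le_sum (s : Finset ℕ) (hs : ∀ i ∈ s, 1 ≤ i) :
    s.card * (s.card + 1) / 2 ≤ ∑ i ∈ s, i := by
  induction s using Finset.induction_on_max with
  | empty => simp
  | insert a s hlt ih =>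
    have ha : a ∉ s := fun h => lt_irrefl _ (hlt a h)
    have hcard : s.card + 1 ≤ a := by
      have hsub : s ⊆ Finset.Ico 1 a := fun i hi =>
        Finset.mem_Ico.2 ⟨hs i (Finset.mem_insert_of_mem hi), hlt i hi⟩
      have := Finset.card_le_card hsub
      have := hs a (Finset.mem_insert_self a s)
      simp only [Nat.card_Ico] at *
      omega
    have hsum := ih fun i hi => hs i (Finset.mem_insert_of_mem hi)
    rw [Finset.card_insert_of_notMem ha, Finset.sum_insert ha,
      show (s.card + 1) * (s.card + 1 + 1) = s.card * (s.card + 1) + (s.card + 1) * 2 by ring,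
      Nat.add_mul_div_right _ _ two_pos]
    omega

/-- The exponent attached to a set of indices. -/
def indexWeight (s : Finset ℕ) : ℕ := (∑ i ∈ s, i) - s.card * (s.card + 1) / 2

theorem aNPK_eq_aFormula (p n k : ℕ) : aNPK p n k = aFormula p n k := by
  unfold aNPK
  split_ifs with h
  · rcases h with rfl | rfl
    · simp [aFormula]
    · have hps : (Finset.Icc 1 k).powersetCard k = {Finset.Icc 1 k} := by
        simpa using Finset.powersetCard_self (Finset.Icc 1 k)
      have hsum : ∑ i ∈ Finset.Icc 1 k, i = k * (k + 1) / 2 := by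
        have h := Finset.sum_range_id (k + 1)
        rw [Finset.range_eq_Ico, Finset.sum_eq_sum_Ico_succ_bot k.succ_pos] at h
        simpa [mul_comm, Finset.Ico_add_one_right_eq_Icc] using h
      simp [aFormula, hps, hsum]
  · rfl

theorem aNP_eq_sum_powerset (p n : ℕ) :
    aNP p n = ∑ s ∈ (Finset.Icc 1 n).powerset, p ^ indexWeight s := by
  rw [Finset.sum_powerset, Nat.card_Icc, Nat.add_sub_cancel]
  refine Finset.sum_congr rfl fun k _ => ?_
  rw [aNPK_eq_aFormula, aFormula]
  refine Finset.sum_congr rfl fun s hs => ?_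
  rw [indexWeight, (Finset.mem_powersetCard.1 hs).2]

/-- If an injection of the subsets of `{1, …, m}` into the subsets of `{1, …, n}` raises the
exponent of each `s` by `d s`, then `a_{n,p}` dominates the sum twisted by `p ^ d s`. -/
theorem sum_mul_pow_le_aNP (p m n : ℕ) (d : Finset ℕ → ℕ) (φ : Finset ℕ → Finset ℕ)
    (hφ : ∀ s ⊆ Finset.Icc 1 m, φ s ⊆ Finset.Icc 1 n)
    (hinj : Set.InjOn φ ((Finset.Icc 1 m).powerset : Set (Finset ℕ)))
    (hw : ∀ s ⊆ Finset.Icc 1 m, indexWeight (φ s) = indexWeight s + d s) :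
    ∑ s ∈ (Finset.Icc 1 m).powerset, p ^ indexWeight s * p ^ d s ≤ aNP p n := by
  calc ∑ s ∈ (Finset.Icc 1 m).powerset, p ^ indexWeight s * p ^ d s
      = ∑ s ∈ (Finset.Icc 1 m).powerset, p ^ indexWeight (φ s) :=
        Finset.sum_congr rfl fun s hs => by rw [hw s (Finset.mem_powerset.1 hs), pow_add]
    _ = ∑ t ∈ (Finset.Icc 1 m).powerset.image φ, p ^ indexWeight t :=
        (Finset.sum_image (f := fun t => p ^ indexWeight t) hinj).symm
    _ ≤ aNP p n := by
        rw [aNP_eq_sum_powerset]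
        refine Finset.sum_le_sum_of_subset fun t ht => ?_
        obtain ⟨s, hs, rfl⟩ := Finset.mem_image.1 ht
        exact Finset.mem_powerset.2 (hφ s (Finset.mem_powerset.1 hs))

theorem sum_mul_pow_card_le_aNP_succ (p m : ℕ) :
    ∑ s ∈ (Finset.Icc 1 m).powerset, p ^ indexWeight s * p ^ s.card ≤ aNP p (m + 1) := by
  refine sum_mul_pow_le_aNP p m (m + 1) _ (Finset.map (addRightEmbedding 1)) ?_
    (Finset.map_injective _).injOn ?_
  · intro s hs i hi
    obtain ⟨j, hj, rfl⟩ := Finset.mem_map.1 hi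
    have := Finset.mem_Icc.1 (hs hj)
    simp only [addRightEmbedding_apply, Finset.mem_Icc]
    omega
  · intro s hs
    have hle := card_mul_card_succ_half_le_sum s fun i hi => (Finset.mem_Icc.1 (hs hi)).1
    simp only [indexWeight, Finset.card_map, Finset.sum_map, addRightEmbedding_apply,
      Finset.sum_add_distrib, Finset.sum_const, smul_eq_mul, mul_one]
    omega

theorem sum_mul_pow_sub_card_le_aNP_succ (p m : ℕ) :
    ∑ s ∈ (Finset.Icc 1 m).powerset, p ^ indexWeight s * p ^ (m - s.card) ≤ aNP p (m + 1) := by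
  have hnotMem : ∀ s ⊆ Finset.Icc 1 m, m + 1 ∉ s := fun s hs h => by
    have := Finset.mem_Icc.1 (hs h)
    omega
  refine sum_mul_pow_le_aNP p m (m + 1) (fun s => m - s.card) (insert (m + 1)) ?_ ?_ ?_
  · intro s hs
    exact Finset.insert_subset (by simp)
      (hs.trans (Finset.Icc_subset_Icc_right (Nat.le_succ m)))
  · intro s hs t ht hst
    rw [← Finset.erase_insert (hnotMem s (Finset.mem_powerset.1 (Finset.mem_coe.1 hs))),
      ← Finset.erase_insert (hnotMem t (Finset.mem_powerset.1 (Finset.mem_coe.1 ht))), hst]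
  · intro s hs
    have hle := card_mul_card_succ_half_le_sum s fun i hi => (Finset.mem_Icc.1 (hs hi)).1
    have hcard : s.card ≤ m := by simpa using Finset.card_le_card hs
    rw [indexWeight, indexWeight, Finset.card_insert_of_notMem (hnotMem s hs),
      Finset.sum_insert (hnotMem s hs),
      show (s.card + 1) * (s.card + 1 + 1) = s.card * (s.card + 1) + (s.card + 1) * 2 by ring,
      Nat.add_mul_div_right _ _ two_pos]
    omega

theorem mul_aNP_le_two_mul_aNP_succ {p : ℕ} (hp : 1 < p) (m : ℕ) :
    m * aNP p m ≤ 2 * aNP p (m + 1) := by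
  calc m * aNP p m
      = ∑ s ∈ (Finset.Icc 1 m).powerset, p ^ indexWeight s * m := by
        rw [aNP_eq_sum_powerset, mul_comm, Finset.sum_mul]
    _ ≤ ∑ s ∈ (Finset.Icc 1 m).powerset,
          (p ^ indexWeight s * p ^ s.card + p ^ indexWeight s * p ^ (m - s.card)) := by
        refine Finset.sum_le_sum fun s _ => ?_
        rw [← mul_add]
        refine Nat.mul_le_mul_left _ ?_
        have h₁ := Nat.lt_pow_self hp (n := s.card)
        have h₂ := Nat.lt_pow_self hp (n := m - s.card)
        omega
    _ ≤ 2 * aNP p (m + 1) := by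
        rw [Finset.sum_add_distrib, two_mul]
        exact add_le_add (sum_mul_pow_card_le_aNP_succ p m)
          (sum_mul_pow_sub_card_le_aNP_succ p m)

theorem aNP_pos (p n : ℕ) : 0 < aNP p n :=
  Finset.sum_pos' (fun _ _ => Nat.zero_le _) ⟨0, by simp, by simp [aNPK]⟩

/-- For a fixed prime `p`, the ratio `a_{n−1,p}/a_{n,p}` tends to `0` as `n → ∞`. -/
theorem aNP_ratio_tendsto_zero (p : ℕ) (hp : p.Prime) :
    Filter.Tendsto (fun n : ℕ => (aNP p (n - 1) : ℝ) / (aNP p n : ℝ))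
      Filter.atTop (nhds 0) := by
  rw [← Filter.tendsto_add_atTop_iff_nat 1]
  refine squeeze_zero' (.of_forall fun m => by positivity) ?_
    (tendsto_const_div_atTop_nhds_zero_nat (2 : ℝ))
  filter_upwards [Filter.eventually_gt_atTop 0] with m hm
  have hpos : (0 : ℝ) < aNP p (m + 1) := by exact_mod_cast aNP_pos p (m + 1)
  rw [Nat.add_sub_cancel, div_le_div_iff₀ hpos (by exact_mod_cast hm), mul_comm]
  exact_mod_cast mul_aNP_le_two_mul_aNP_succ hp.one_lt m
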